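/- arXiv:2506.06947 — 2 statements merged into one kernel-verified Lean document; each statement's English description precedes it below -/
import Mathlib

section
/- There exists a finite constant C depending only on d, α and δ such that for every ξ ∈ ℝ^d and every r > 0 one has ∫_{|η| > r} |P⊥_{ξ−η} η|² ⟨ξ−η⟩^{−(d+2α)} · ((1+|η|²)^δ − |η|^{2δ}) / (|η|^{2δ}(1+|η|²)^δ) dη ≤ C r^{−2δ}. -/
open MeasureTheory Real

noncomputable section

/-- Orthogonal projection of `w` onto the orthogonal complement of `span {v}`
(for `v = 0` this formula returns `w` itself, an irrelevant convention). -/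
def Pperp (d : ℕ) (v w : EuclideanSpace ℝ (Fin d)) : EuclideanSpace ℝ (Fin d) :=
  w - (((inner ℝ v w : ℝ)) / ‖v‖ ^ 2) • v

/-- Japanese bracket `⟨ξ⟩ = (1 + |ξ|²)^{1/2}`. -/
def jb (d : ℕ) (ξ : EuclideanSpace ℝ (Fin d)) : ℝ := Real.sqrt (1 + ‖ξ‖ ^ 2)

theorem Pperp_norm_le (d : ℕ) (v w : EuclideanSpace ℝ (Fin d)) : ‖Pperp d v w‖ ^ 2 ≤ ‖w‖ ^ 2 := by
  unfold Pperp
  by_cases hv : v = 0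
  · simp [hv]
  have hv' : 0 < ‖v‖ := norm_pos_iff.mpr hv
  rw [norm_sub_sq_real, inner_smul_right, norm_smul, mul_pow, Real.norm_eq_abs, sq_abs,
    real_inner_comm v w]
  have : (inner ℝ v w / ‖v‖ ^ 2) ^ 2 * ‖v‖ ^ 2 = inner ℝ v w / ‖v‖ ^ 2 * inner ℝ v w := by
    field_simp
  rw [this]
  have h2 : 0 ≤ inner ℝ v w / ‖v‖ ^ 2 * inner ℝ v w := by
    rw [← this]; positivity
  linarith

theorem weight_nonneg (δ a : ℝ) (h0 : 0 < δ) (ha : 0 < a) :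
    0 ≤ ((1 + a ^ 2) ^ δ - a ^ (2 * δ)) / (a ^ (2 * δ) * (1 + a ^ 2) ^ δ) := by
  have e : a ^ (2 * δ) = (a ^ 2) ^ δ := by
    rw [Real.rpow_mul ha.le]; norm_num
  rw [e]
  have : (a ^ 2) ^ δ ≤ (1 + a ^ 2) ^ δ :=
    Real.rpow_le_rpow (by positivity) (by linarith) h0.le
  apply div_nonneg (by linarith) (by positivity)

theorem weight_le (δ a r : ℝ) (h0 : 0 < δ) (h1 : δ < 1) (hr : 0 < r) (ha : r < a) :
    a ^ 2 * (((1 + a ^ 2) ^ δ - a ^ (2 * δ)) / (a ^ (2 * δ) * (1 + a ^ 2) ^ δ))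
      ≤ r ^ (-(2 * δ)) := by
  have ha0 : 0 < a := hr.trans ha
  have e : a ^ (2 * δ) = (a ^ 2) ^ δ := by
    rw [Real.rpow_mul ha0.le]; norm_num
  have hx : 0 < a ^ 2 := by positivity
  have h3 : a ^ (-(2 * δ)) ≤ r ^ (-(2 * δ)) :=
    Real.rpow_le_rpow_of_nonpos hr ha.le (by linarith)
  refine le_trans ?_ h3
  rw [Real.rpow_neg ha0.le, e]
  generalize a ^ 2 = x at hx
  have hxd : 0 < x ^ δ := by positivity
  have hxd1 : 0 < (1 + x) ^ δ := by positivity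
  have hle : x ^ δ ≤ (1 + x) ^ δ := Real.rpow_le_rpow hx.le (by linarith) h0.le
  have hb : (1 + x) ^ δ ≤ x ^ δ * (1 + 1 / x) := by
    have : 1 + x = x * (1 + 1 / x) := by field_simp; ring
    rw [this, Real.mul_rpow hx.le (by positivity)]
    gcongr
    have h1x : 0 < 1 / x := by positivity
    calc (1 + 1 / x) ^ δ ≤ (1 + 1 / x) ^ (1 : ℝ) :=
          Real.rpow_le_rpow_of_exponent_le (by linarith) h1.le
      _ = _ := Real.rpow_one _
  have hc : x * (1 + x) ^ δ ≤ x ^ δ * x + x ^ δ := by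
    calc x * (1 + x) ^ δ ≤ x * (x ^ δ * (1 + 1 / x)) := by gcongr
      _ = _ := by field_simp
  rw [← mul_div_assoc, div_le_iff₀ (by positivity), inv_mul_cancel_left₀ hxd.ne']
  nlinarith

theorem jb_integrable (d : ℕ) (α : ℝ) (hα : 0 < α) :
    Integrable (fun ζ : EuclideanSpace ℝ (Fin d) => jb d ζ ^ (-((d : ℝ) + 2 * α))) := by
  have h := integrable_rpow_neg_one_add_norm_sq (E := EuclideanSpace ℝ (Fin d)) (μ := volume)
    (r := (d : ℝ) + 2 * α) (by simp; linarith)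
  convert h using 2 with ζ
  unfold jb
  rw [Real.sqrt_eq_rpow, ← Real.rpow_mul (by positivity)]
  congr 1; ring

theorem jb_nonneg (d : ℕ) (ζ : EuclideanSpace ℝ (Fin d)) (s : ℝ) : 0 ≤ jb d ζ ^ s :=
  Real.rpow_nonneg (Real.sqrt_nonneg _) _

/-- There exists a finite constant `C = C(d,α,δ)` such that for every `ξ ∈ ℝ^d` and `r > 0`,
`∫_{|η|>r} |P⊥_{ξ−η} η|² ⟨ξ−η⟩^{−(d+2α)} ((1+|η|²)^δ − |η|^{2δ}) / (|η|^{2δ}(1+|η|²)^δ) dη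
  ≤ C r^{−2δ}`. -/
theorem stmt3 (d : ℕ) (hd : 2 ≤ d) (α δ : ℝ)
    (hα : α ∈ Set.Ioo (0 : ℝ) (1 / 2)) (hδ : δ ∈ Set.Ioo (0 : ℝ) 1) :
    ∃ C : ℝ, 0 ≤ C ∧
      ∀ ξ : EuclideanSpace ℝ (Fin d), ∀ r : ℝ, 0 < r →
        (∫ η in {η : EuclideanSpace ℝ (Fin d) | r < ‖η‖},
            ‖Pperp d (ξ - η) η‖ ^ 2 * jb d (ξ - η) ^ (-((d : ℝ) + 2 * α)) *
              (((1 + ‖η‖ ^ 2) ^ δ - ‖η‖ ^ (2 * δ)) / (‖η‖ ^ (2 * δ) * (1 + ‖η‖ ^ 2) ^ δ)))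
          ≤ C * r ^ (-(2 * δ)) := by
  obtain ⟨hα0, -⟩ := hα
  obtain ⟨h0, h1⟩ := hδ
  have hi := jb_integrable d α hα0
  refine ⟨∫ ζ, jb d ζ ^ (-((d : ℝ) + 2 * α)), integral_nonneg fun ζ => jb_nonneg d ζ _, ?_⟩
  intro ξ r hr
  have hms : MeasurableSet {η : EuclideanSpace ℝ (Fin d) | r < ‖η‖} :=
    measurableSet_lt measurable_const measurable_norm
  have hi2 : Integrable (fun η => jb d (ξ - η) ^ (-((d : ℝ) + 2 * α)) * r ^ (-(2 * δ))) :=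
    (hi.comp_sub_left ξ).mul_const _
  have hr2 : 0 ≤ r ^ (-(2 * δ)) := Real.rpow_nonneg hr.le _
  calc _ ≤ ∫ η in {η : EuclideanSpace ℝ (Fin d) | r < ‖η‖},
          jb d (ξ - η) ^ (-((d : ℝ) + 2 * α)) * r ^ (-(2 * δ)) := by
        apply integral_mono_of_nonneg _ hi2.integrableOn
        · filter_upwards [ae_restrict_mem hms] with η hη
          have hη' : r < ‖η‖ := hη
          have hw := weight_nonneg δ ‖η‖ h0 (hr.trans hη')
          calc _ = jb d (ξ - η) ^ (-((d : ℝ) + 2 * α)) * (‖Pperp d (ξ - η) η‖ ^ 2 * (((1 + ‖η‖ ^ 2) ^ δ - ‖η‖ ^ (2 * δ)) / (‖η‖ ^ (2 * δ) * (1 + ‖η‖ ^ 2) ^ δ))) := by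
                ring
            _ ≤ _ := by
                refine mul_le_mul_of_nonneg_left ?_ (jb_nonneg d _ _)
                refine le_trans ?_ (weight_le δ ‖η‖ r h0 h1 hr hη')
                exact mul_le_mul_of_nonneg_right (Pperp_norm_le d _ _) hw
        · filter_upwards [ae_restrict_mem hms] with η hη
          have hη' : r < ‖η‖ := hη
          exact mul_nonneg (mul_nonneg (by positivity) (jb_nonneg d _ _))
            (weight_nonneg δ ‖η‖ h0 (hr.trans hη'))
    _ ≤ ∫ η, jb d (ξ - η) ^ (-((d : ℝ) + 2 * α)) * r ^ (-(2 * δ)) :=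
        setIntegral_le_integral hi2
          (Filter.Eventually.of_forall fun η => mul_nonneg (jb_nonneg d _ _) hr2)
    _ = _ := by
        rw [integral_mul_const,
          integral_sub_left_eq_self (fun ζ => jb d ζ ^ (-((d : ℝ) + 2 * α))) volume ξ]

end
end

section
/- Assume moreover δ ∈ (1−α, 1), and fix t > 0. Set ψ_n(ξ) := φ_n(|ξ|)⟨ξ⟩^{−2δ} and ψ(ξ) := ⟨ξ⟩^{−2δ}. Let a : [0,t] × ℝ^d → [0,∞) be measurable with ess sup_{s ∈ [0,t]} ∫_{ℝ^d} a_s(ξ) dξ < ∞. Then the iterated integrals ∫_0^t ∫_{ℝ^d} ∫_{ℝ^d} K(ξ,η) a_s(ξ)(ψ_n(η) − ψ_n(ξ)) dη dξ ds and ∫_0^t ∫_{ℝ^d} ∫_{ℝ^d} K(ξ,η) a_s(ξ)(ψ(η) − ψ(ξ)) dη dξ ds are absolutely convergent, and the former converges to the latter as n → ∞. -/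
open MeasureTheory Real Filter Topology
open scoped ENNReal

noncomputable section

/-- The kernel `K(ξ,η) = |P⊥_{ξ-η} ξ|² ⟨ξ-η⟩^{-(d+2α)}`. -/
def Kker (d : ℕ) (α : ℝ) (ξ η : EuclideanSpace ℝ (Fin d)) : ℝ :=
  ‖Pperp d (ξ - η) ξ‖ ^ 2 * jb d (ξ - η) ^ (-((d : ℝ) + 2 * α))

/-- `φ_n(r) := φ(r/n)`. -/
def phin (φ : ℝ → ℝ) (n : ℕ) (r : ℝ) : ℝ := φ (r / n)

/-- `ψ_n(ξ) := φ_n(|ξ|) ⟨ξ⟩^{−2δ}`. -/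
def psin (d : ℕ) (δ : ℝ) (φ : ℝ → ℝ) (n : ℕ) (ξ : EuclideanSpace ℝ (Fin d)) : ℝ :=
  phin φ n ‖ξ‖ * jb d ξ ^ (-(2 * δ))

/-- `ψ(ξ) := ⟨ξ⟩^{−2δ}`. -/
def psiinf (d : ℕ) (δ : ℝ) (ξ : EuclideanSpace ℝ (Fin d)) : ℝ :=
  jb d ξ ^ (-(2 * δ))

lemma jb_rpow (d : ℕ) (x : EuclideanSpace ℝ (Fin d)) (y : ℝ) :
    jb d x ^ y = (1 + ‖x‖ ^ 2) ^ (y / 2) := by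
  unfold jb
  rw [Real.sqrt_eq_rpow, ← Real.rpow_mul (by positivity)]
  congr 1
  ring

lemma norm_Pperp_le (d : ℕ) (v w : EuclideanSpace ℝ (Fin d)) : ‖Pperp d v w‖ ≤ ‖w‖ := by
  unfold Pperp
  by_cases hv : v = 0
  · simp [hv]
  have hv' : 0 < ‖v‖ := norm_pos_iff.mpr hv
  refine le_of_sq_le_sq ?_ (norm_nonneg _)
  rw [norm_sub_sq_real, inner_smul_right, norm_smul, real_inner_comm v w, mul_pow,
    Real.norm_eq_abs, sq_abs]
  have h : (inner ℝ v w / ‖v‖ ^ 2) ^ 2 * ‖v‖ ^ 2 = inner ℝ v w / ‖v‖ ^ 2 * inner ℝ v w := by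
    field_simp
  have h2 : 0 ≤ inner ℝ v w / ‖v‖ ^ 2 * inner ℝ v w := by
    rw [← h]; positivity
  rw [h]
  linarith

lemma Pperp_sub (d : ℕ) (ξ η : EuclideanSpace ℝ (Fin d)) :
    Pperp d (ξ - η) ξ = Pperp d (ξ - η) η := by
  by_cases hv : ξ - η = 0
  · have : ξ = η := sub_eq_zero.mp hv
    rw [this]
  have hv' : ‖ξ - η‖ ^ 2 ≠ 0 := by
    have : 0 < ‖ξ - η‖ := norm_pos_iff.mpr hv
    positivity
  unfold Pperp
  have h : inner ℝ (ξ - η) ξ / ‖ξ - η‖ ^ 2 = 1 + inner ℝ (ξ - η) η / ‖ξ - η‖ ^ 2 := by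
    field_simp
    rw [← real_inner_self_eq_norm_sq, ← inner_add_right]
    simp
  rw [h, add_smul, one_smul]
  abel

/-- The radial one-variable estimate. -/
lemma radial_bound (δ L : ℝ) (hL : 0 ≤ L) (hδ1 : 1 / 2 < δ) (hδ2 : δ < 1) (φ : ℝ → ℝ)
    (hφ_range : ∀ r : ℝ, 0 ≤ r → φ r ∈ Set.Icc (0 : ℝ) 1)
    (hφ_zero : ∀ r : ℝ, 2 ≤ r → φ r = 0)
    (hLip : ∀ x ∈ Set.Icc (0 : ℝ) 4, ∀ y ∈ Set.Icc (0 : ℝ) 4, |φ x - φ y| ≤ L * |x - y|)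
    (q r s : ℝ) (hq : 0 ≤ q) (hr : 0 ≤ r) (hrs : r ≤ s) :
    r ^ 2 * (φ (r * q) * (1 + r ^ 2) ^ (-δ) - φ (s * q) * (1 + s ^ 2) ^ (-δ)) ≤
      (2 * L + 2) * (1 + (s - r) ^ 2) ^ (1 - δ) := by
  have hs : 0 ≤ s := hr.trans hrs
  have hA : (0 : ℝ) < 1 + r ^ 2 := by positivity
  have hB : (0 : ℝ) < 1 + s ^ 2 := by positivity
  have hH : (0 : ℝ) < 1 + (s - r) ^ 2 := by positivity
  obtain ⟨p0, p1⟩ := hφ_range (r * q) (by positivity)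
  obtain ⟨q0, q1⟩ := hφ_range (s * q) (by positivity)
  have hpr : 0 < (1 + r ^ 2) ^ (-δ) := Real.rpow_pos_of_pos hA _
  have hps : 0 < (1 + s ^ 2) ^ (-δ) := Real.rpow_pos_of_pos hB _
  have hph : 0 < (1 + (s - r) ^ 2) ^ (1 - δ) := Real.rpow_pos_of_pos hH _
  by_cases hc : r ≤ s - r
  · have h1 : φ (r * q) * (1 + r ^ 2) ^ (-δ) - φ (s * q) * (1 + s ^ 2) ^ (-δ)
        ≤ (1 + r ^ 2) ^ (-δ) := by nlinarith [mul_nonneg q0 hps.le]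
    have h2 : (1 + r ^ 2) * (1 + r ^ 2) ^ (-δ) = (1 + r ^ 2) ^ (1 - δ) := by
      rw [sub_eq_add_neg, Real.rpow_add hA, Real.rpow_one]
    have h3 : (1 + r ^ 2) ^ (1 - δ) ≤ (1 + (s - r) ^ 2) ^ (1 - δ) := by
      apply Real.rpow_le_rpow hA.le _ (by linarith)
      nlinarith
    have h4 := mul_le_mul_of_nonneg_left h1 (sq_nonneg r)
    nlinarith [mul_nonneg hL hph.le]
  · push Not at hc
    set h := s - r with hh
    have hh0 : 0 ≤ h := by linarith
    have hr0 : 0 < r := by linarith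
    -- first piece
    have e1 : r * (φ (r * q) - φ (s * q)) ≤ 2 * L * h := by
      by_cases hrq : 2 ≤ r * q
      · rw [hφ_zero _ hrq]
        nlinarith [mul_nonneg hL hh0, mul_nonneg hr q0]
      · push Not at hrq
        have := hLip (r * q) ⟨by positivity, by linarith⟩ (s * q)
          ⟨by positivity, by nlinarith⟩
        have h5 : |r * q - s * q| = h * q := by
          rw [abs_sub_comm, abs_of_nonneg]
          · rw [hh]; ring
          · nlinarith
        rw [h5] at this
        have h6 := (le_abs_self _).trans this
        have h7 := mul_le_mul_of_nonneg_left h6 hr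
        nlinarith [mul_nonneg hL hh0]
    -- second piece
    have e2 : r * ((1 + r ^ 2) ^ (-δ) - (1 + s ^ 2) ^ (-δ)) ≤ 2 * h * (1 + r ^ 2) ^ (-δ) := by
      have hx1 : (1 + r ^ 2) / (1 + s ^ 2) ≤ 1 := by
        rw [div_le_one hB]; nlinarith
      have hx0 : 0 < (1 + r ^ 2) / (1 + s ^ 2) := by positivity
      have hx : (1 + r ^ 2) / (1 + s ^ 2) ≤ ((1 + r ^ 2) / (1 + s ^ 2)) ^ δ := by
        have := Real.rpow_le_rpow_of_exponent_ge hx0 hx1 hδ2.le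
        rwa [Real.rpow_one] at this
      have hy : (1 + s ^ 2) ^ (-δ) = (1 + r ^ 2) ^ (-δ) * ((1 + r ^ 2) / (1 + s ^ 2)) ^ δ := by
        rw [Real.div_rpow hA.le hB.le, Real.rpow_neg hA.le, Real.rpow_neg hB.le]
        have : (1 + r ^ 2) ^ δ ≠ 0 := (Real.rpow_pos_of_pos hA _).ne'
        field_simp
      have hz : r * (1 - (1 + r ^ 2) / (1 + s ^ 2)) ≤ 2 * h := by
        have : r * (1 - (1 + r ^ 2) / (1 + s ^ 2)) = r * (h * (s + r)) / (1 + s ^ 2) := by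
          field_simp
          rw [hh]; ring
        rw [this, div_le_iff₀ hB]
        nlinarith [mul_nonneg hh0 (mul_nonneg hr (sub_nonneg.2 hrs)),
          mul_nonneg hh0 (mul_nonneg hs (sub_nonneg.2 hrs))]
      rw [hy]
      have h8 : r * (1 - ((1 + r ^ 2) / (1 + s ^ 2)) ^ δ) ≤ 2 * h :=
        le_trans (mul_le_mul_of_nonneg_left (by linarith) hr) hz
      nlinarith [mul_le_mul_of_nonneg_right h8 hpr.le]
    -- final
    have e3 : r * h * (1 + r ^ 2) ^ (-δ) ≤ (1 + h ^ 2) ^ (1 - δ) := by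
      have a1 : r ≤ (1 + r ^ 2) ^ (1 / 2 : ℝ) := by
        rw [← Real.sqrt_eq_rpow]; apply Real.le_sqrt_of_sq_le; linarith
      have a2 : h ≤ (1 + h ^ 2) ^ (1 / 2 : ℝ) := by
        rw [← Real.sqrt_eq_rpow]; apply Real.le_sqrt_of_sq_le; linarith
      have a3 : (1 + r ^ 2) ^ (1 / 2 : ℝ) * (1 + r ^ 2) ^ (-δ) = (1 + r ^ 2) ^ (1 / 2 - δ) := by
        rw [← Real.rpow_add hA]; rfl
      have a4 : (1 + h ^ 2) ^ (1 / 2 : ℝ) * (1 + h ^ 2) ^ (1 / 2 - δ) = (1 + h ^ 2) ^ (1 - δ) := by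
        rw [← Real.rpow_add hH]; congr 1; ring
      have a5 : (1 + r ^ 2) ^ (1 / 2 - δ) ≤ (1 + h ^ 2) ^ (1 / 2 - δ) := by
        apply Real.rpow_le_rpow_of_nonpos hH _ (by linarith)
        nlinarith
      calc r * h * (1 + r ^ 2) ^ (-δ) = h * (r * (1 + r ^ 2) ^ (-δ)) := by ring
        _ ≤ h * ((1 + r ^ 2) ^ (1 / 2 : ℝ) * (1 + r ^ 2) ^ (-δ)) := by gcongr
        _ = h * (1 + r ^ 2) ^ (1 / 2 - δ) := by rw [a3]
        _ ≤ (1 + h ^ 2) ^ (1 / 2 : ℝ) * (1 + h ^ 2) ^ (1 / 2 - δ) := by gcongr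
        _ = _ := a4
    have m1 := mul_le_mul_of_nonneg_left e1 (mul_nonneg hr hpr.le)
    have m3 : φ (s * q) * (r * (r * ((1 + r ^ 2) ^ (-δ) - (1 + s ^ 2) ^ (-δ)))) ≤
        r * (2 * h * (1 + r ^ 2) ^ (-δ)) := by
      have m2 := mul_le_mul_of_nonneg_left e2 hr
      have m4 : 0 ≤ r * (2 * h * (1 + r ^ 2) ^ (-δ)) := by positivity
      nlinarith [mul_le_mul_of_nonneg_left m2 q0]
    have m5 := mul_le_mul_of_nonneg_left e3 (by positivity : 0 ≤ 2 * L + 2)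
    nlinarith

/-- The pointwise kernel bound, uniform in `n`. -/
lemma kernel_bound (d : ℕ) (α δ L : ℝ) (hL : 0 ≤ L) (hδ1 : 1 / 2 < δ) (hδ2 : δ < 1) (φ : ℝ → ℝ)
    (hφ_anti : AntitoneOn φ (Set.Ici 0))
    (hφ_range : ∀ r : ℝ, 0 ≤ r → φ r ∈ Set.Icc (0 : ℝ) 1)
    (hφ_zero : ∀ r : ℝ, 2 ≤ r → φ r = 0)
    (hLip : ∀ x ∈ Set.Icc (0 : ℝ) 4, ∀ y ∈ Set.Icc (0 : ℝ) 4, |φ x - φ y| ≤ L * |x - y|)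
    (n : ℕ) (ξ η : EuclideanSpace ℝ (Fin d)) :
    Kker d α ξ η * |psin d δ φ n η - psin d δ φ n ξ| ≤
      (2 * L + 2) * (1 + ‖ξ - η‖ ^ 2) ^ (-((d : ℝ) + 2 * (α + δ - 1)) / 2) := by
  have key : ∀ x y : EuclideanSpace ℝ (Fin d), ‖x‖ ≤ ‖y‖ →
      ‖x‖ ^ 2 * |psin d δ φ n y - psin d δ φ n x| ≤
        (2 * L + 2) * (1 + ‖x - y‖ ^ 2) ^ (1 - δ) := by
    intro x y hxy
    have hn : (0 : ℝ) ≤ (n : ℝ)⁻¹ := by positivity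
    have hb := radial_bound δ L hL hδ1 hδ2 φ hφ_range hφ_zero hLip (n : ℝ)⁻¹ ‖x‖ ‖y‖ hn
      (norm_nonneg _) hxy
    have hmono : psin d δ φ n y ≤ psin d δ φ n x := by
      unfold psin phin
      rw [jb_rpow, jb_rpow]
      apply mul_le_mul
      · apply hφ_anti
        · exact Set.mem_Ici.2 (by positivity)
        · exact Set.mem_Ici.2 (by positivity)
        · gcongr
      · apply Real.rpow_le_rpow_of_nonpos (by positivity) (by gcongr) (by linarith)
      · positivity
      · exact (hφ_range _ (by positivity)).1
    rw [abs_sub_comm, abs_of_nonneg (by linarith)]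
    have e : psin d δ φ n x - psin d δ φ n y = φ (‖x‖ * (n : ℝ)⁻¹) * (1 + ‖x‖ ^ 2) ^ (-δ) -
        φ (‖y‖ * (n : ℝ)⁻¹) * (1 + ‖y‖ ^ 2) ^ (-δ) := by
      unfold psin phin
      have : -(2 * δ) / 2 = -δ := by ring
      rw [jb_rpow, jb_rpow, this, div_eq_mul_inv, div_eq_mul_inv]
    rw [e]
    refine hb.trans ?_
    have h1 : (‖y‖ - ‖x‖) ^ 2 ≤ ‖x - y‖ ^ 2 := by
      have := norm_sub_norm_le y x
      rw [norm_sub_rev] at this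
      have h0 : 0 ≤ ‖y‖ - ‖x‖ := by linarith
      gcongr
    have h2 : (0 : ℝ) ≤ 1 - δ := by linarith
    gcongr
  have key2 : ‖Pperp d (ξ - η) ξ‖ ^ 2 * |psin d δ φ n η - psin d δ φ n ξ| ≤
        (2 * L + 2) * (1 + ‖ξ - η‖ ^ 2) ^ (1 - δ) := by
    rcases le_total ‖ξ‖ ‖η‖ with h | h
    · refine le_trans ?_ (key ξ η h)
      have := norm_Pperp_le d (ξ - η) ξ
      gcongr
    · have := key η ξ h
      rw [norm_sub_rev, abs_sub_comm] at this
      refine le_trans ?_ this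
      rw [Pperp_sub]
      have := norm_Pperp_le d (ξ - η) η
      gcongr
  unfold Kker
  rw [jb_rpow]
  have hp : (0 : ℝ) < 1 + ‖ξ - η‖ ^ 2 := by positivity
  have hsplit : (1 + ‖ξ - η‖ ^ 2) ^ (-((d : ℝ) + 2 * (α + δ - 1)) / 2) =
      (1 + ‖ξ - η‖ ^ 2) ^ (1 - δ) * (1 + ‖ξ - η‖ ^ 2) ^ (-((d : ℝ) + 2 * α) / 2) := by
    rw [← Real.rpow_add hp]; congr 1; ring
  rw [hsplit]
  have := mul_le_mul_of_nonneg_right key2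
    (Real.rpow_pos_of_pos hp (-((d : ℝ) + 2 * α) / 2)).le
  nlinarith

/-- Integrability of the dominating function. -/
lemma integrable_bound (d : ℕ) (t ε : ℝ) (hε : 0 < ε)
    (a : ℝ → EuclideanSpace ℝ (Fin d) → ℝ)
    (ha_meas : Measurable (Function.uncurry a))
    (ha_nonneg : ∀ s ξ, 0 ≤ a s ξ)
    (ha_bdd : ∃ Ca : ℝ≥0∞, Ca ≠ ⊤ ∧
      ∀ᵐ s ∂(volume.restrict (Set.Icc (0 : ℝ) t)),
        (∫⁻ ξ : EuclideanSpace ℝ (Fin d), ENNReal.ofReal (a s ξ)) ≤ Ca) :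
    Integrable (fun p : ℝ × (EuclideanSpace ℝ (Fin d) × EuclideanSpace ℝ (Fin d)) =>
      a p.1 p.2.1 * (1 + ‖p.2.1 - p.2.2‖ ^ 2) ^ (-((d : ℝ) + ε) / 2))
      ((volume.restrict (Set.Icc (0 : ℝ) t)).prod (volume.prod volume)) := by
  obtain ⟨Ca, hCa, hbd⟩ := ha_bdd
  set g : EuclideanSpace ℝ (Fin d) → ℝ := fun z => (1 + ‖z‖ ^ 2) ^ (-((d : ℝ) + ε) / 2) with hg
  have hgm : Measurable g := by fun_prop
  have hg0 : ∀ z, 0 ≤ g z := fun z => by positivity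
  have hgi : Integrable g volume := by
    apply integrable_rpow_neg_one_add_norm_sq
    simp [hε]
  have ham : Measurable (fun p : ℝ × (EuclideanSpace ℝ (Fin d) × EuclideanSpace ℝ (Fin d)) =>
      a p.1 p.2.1) :=
    ha_meas.comp (by fun_prop : Measurable
      (fun p : ℝ × (EuclideanSpace ℝ (Fin d) × EuclideanSpace ℝ (Fin d)) => (p.1, p.2.1)))
  have hm : Measurable (fun p : ℝ × (EuclideanSpace ℝ (Fin d) × EuclideanSpace ℝ (Fin d)) =>
      a p.1 p.2.1 * g (p.2.1 - p.2.2)) := ham.mul (by fun_prop)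
  have hgl : (∫⁻ z, ENNReal.ofReal (g z)) ≠ ⊤ := hgi.lintegral_lt_top.ne
  refine ⟨hm.aestronglyMeasurable, ?_⟩
  rw [hasFiniteIntegral_iff_ofReal (ae_of_all _ fun p => mul_nonneg (ha_nonneg _ _) (hg0 _))]
  rw [lintegral_prod _ hm.ennreal_ofReal.aemeasurable]
  have hin : ∀ s, (∫⁻ y : EuclideanSpace ℝ (Fin d) × EuclideanSpace ℝ (Fin d),
      ENNReal.ofReal (a s y.1 * g (y.1 - y.2)) ∂(volume.prod volume)) =
      (∫⁻ ξ, ENNReal.ofReal (a s ξ)) * ∫⁻ z, ENNReal.ofReal (g z) := by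
    intro s
    have hms : Measurable (fun y : EuclideanSpace ℝ (Fin d) × EuclideanSpace ℝ (Fin d) =>
      a s y.1 * g (y.1 - y.2)) := hm.comp (measurable_prodMk_left (x := s))
    have has : Measurable (fun ξ => ENNReal.ofReal (a s ξ)) :=
      (ha_meas.comp (measurable_prodMk_left (x := s))).ennreal_ofReal
    rw [lintegral_prod _ hms.ennreal_ofReal.aemeasurable, ← lintegral_mul_const _ has]
    congr 1
    funext ξ
    simp only
    simp_rw [ENNReal.ofReal_mul (ha_nonneg s ξ)]
    rw [lintegral_const_mul _ (by fun_prop)]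
    congr 1
    exact lintegral_sub_left_eq_self (fun z => ENNReal.ofReal (g z)) ξ
  simp only [] at hin ⊢
  calc _ = ∫⁻ s in Set.Icc (0 : ℝ) t, (∫⁻ ξ, ENNReal.ofReal (a s ξ)) *
        ∫⁻ z, ENNReal.ofReal (g z) := lintegral_congr hin
    _ ≤ ∫⁻ s in Set.Icc (0 : ℝ) t, Ca * ∫⁻ z, ENNReal.ofReal (g z) := by
        apply lintegral_mono_ae
        filter_upwards [hbd] with s hs
        gcongr
    _ < ⊤ := by
        rw [lintegral_const]
        refine ENNReal.mul_lt_top (ENNReal.mul_lt_top hCa.lt_top hgl.lt_top) ?_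
        simp

lemma measurable_psin (d : ℕ) (δ : ℝ) (φ : ℝ → ℝ) (hφ : ContinuousOn φ (Set.Ici 0)) (n : ℕ) :
    Measurable (psin d δ φ n) := by
  unfold psin phin jb
  refine Measurable.mul ?_ (by fun_prop)
  exact (hφ.comp_continuous (by fun_prop) (fun x => Set.mem_Ici.2 (by positivity))).measurable

lemma measurable_Kker (d : ℕ) (α : ℝ) :
    Measurable (fun y : EuclideanSpace ℝ (Fin d) × EuclideanSpace ℝ (Fin d) =>
      Kker d α y.1 y.2) := by
  unfold Kker Pperp jb
  have h1 : Measurable (fun y : EuclideanSpace ℝ (Fin d) × EuclideanSpace ℝ (Fin d) =>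
    (inner ℝ (y.1 - y.2) y.1 : ℝ)) := (by fun_prop : Continuous _).measurable
  fun_prop

lemma Kker_nonneg (d : ℕ) (α : ℝ) (ξ η : EuclideanSpace ℝ (Fin d)) : 0 ≤ Kker d α ξ η := by
  unfold Kker jb
  positivity

lemma integral_triple (d : ℕ) (t : ℝ)
    (F : ℝ → EuclideanSpace ℝ (Fin d) → EuclideanSpace ℝ (Fin d) → ℝ)
    (hF : Integrable (fun p : ℝ × (EuclideanSpace ℝ (Fin d) × EuclideanSpace ℝ (Fin d)) =>
      F p.1 p.2.1 p.2.2) ((volume.restrict (Set.Icc (0 : ℝ) t)).prod (volume.prod volume))) :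
    (∫ s in Set.Icc (0 : ℝ) t, ∫ ξ, ∫ η, F s ξ η) =
      ∫ p, F p.1 p.2.1 p.2.2 ∂((volume.restrict (Set.Icc (0 : ℝ) t)).prod
        ((volume : Measure (EuclideanSpace ℝ (Fin d))).prod
          (volume : Measure (EuclideanSpace ℝ (Fin d))))) := by
  rw [integral_prod _ hF]
  apply integral_congr_ae
  filter_upwards [hF.prod_right_ae] with s hs
  exact (integral_prod _ hs).symm

/-- Assume moreover `δ ∈ (1−α,1)`, and fix `t > 0`.  Let `a : [0,t] × ℝ^d → [0,∞)` be
measurable with `ess sup_{s∈[0,t]} ∫ a_s(ξ) dξ < ∞`.  Then the iterated integrals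
`∫_0^t ∫∫ K(ξ,η) a_s(ξ)(ψ_n(η) − ψ_n(ξ)) dη dξ ds` and the analogous integral with `ψ`
are absolutely convergent (i.e. the integrands are integrable on the product space,
which is the same by Tonelli), and the former converges to the latter as `n → ∞`. -/
theorem stmt6 (d : ℕ) (hd : 2 ≤ d) (α δ : ℝ)
    (hα : α ∈ Set.Ioo (0 : ℝ) (1 / 2)) (hδ : δ ∈ Set.Ioo (0 : ℝ) 1)
    (hδα : 1 - α < δ) (t : ℝ) (ht : 0 < t)
    (φ : ℝ → ℝ)
    (hφ_smooth : ContDiffOn ℝ (⊤ : ℕ∞) φ (Set.Ici 0))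
    (hφ_anti : AntitoneOn φ (Set.Ici 0))
    (hφ_range : ∀ r : ℝ, 0 ≤ r → φ r ∈ Set.Icc (0 : ℝ) 1)
    (hφ_one : ∀ r ∈ Set.Icc (0 : ℝ) 1, φ r = 1)
    (hφ_zero : ∀ r : ℝ, 2 ≤ r → φ r = 0)
    (a : ℝ → EuclideanSpace ℝ (Fin d) → ℝ)
    (ha_meas : Measurable (Function.uncurry a))
    (ha_nonneg : ∀ s ξ, 0 ≤ a s ξ)
    (ha_bdd : ∃ Ca : ℝ≥0∞, Ca ≠ ⊤ ∧
      ∀ᵐ s ∂(volume.restrict (Set.Icc (0 : ℝ) t)),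
        (∫⁻ ξ : EuclideanSpace ℝ (Fin d), ENNReal.ofReal (a s ξ)) ≤ Ca) :
    (∀ n : ℕ, 1 ≤ n →
      Integrable
        (fun p : ℝ × (EuclideanSpace ℝ (Fin d) × EuclideanSpace ℝ (Fin d)) =>
          Kker d α p.2.1 p.2.2 * a p.1 p.2.1 * (psin d δ φ n p.2.2 - psin d δ φ n p.2.1))
        ((volume.restrict (Set.Icc (0 : ℝ) t)).prod (volume.prod volume))) ∧
    Integrable
      (fun p : ℝ × (EuclideanSpace ℝ (Fin d) × EuclideanSpace ℝ (Fin d)) =>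
        Kker d α p.2.1 p.2.2 * a p.1 p.2.1 * (psiinf d δ p.2.2 - psiinf d δ p.2.1))
      ((volume.restrict (Set.Icc (0 : ℝ) t)).prod (volume.prod volume)) ∧
    Tendsto
      (fun n : ℕ => ∫ s in Set.Icc (0 : ℝ) t, ∫ ξ : EuclideanSpace ℝ (Fin d),
        ∫ η : EuclideanSpace ℝ (Fin d), Kker d α ξ η * a s ξ * (psin d δ φ n η - psin d δ φ n ξ))
      atTop
      (𝓝 (∫ s in Set.Icc (0 : ℝ) t, ∫ ξ : EuclideanSpace ℝ (Fin d),
        ∫ η : EuclideanSpace ℝ (Fin d), Kker d α ξ η * a s ξ * (psiinf d δ η - psiinf d δ ξ))) := by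
  obtain ⟨hα0, hα1⟩ := hα
  obtain ⟨hδ0, hδ1⟩ := hδ
  have hφc : ContinuousOn φ (Set.Ici 0) := hφ_smooth.continuousOn
  obtain ⟨L, hLw⟩ : ∃ L, LipschitzOnWith L φ (Set.Icc 0 4) :=
    (hφ_smooth.mono (fun x hx => hx.1)).exists_lipschitzOnWith (by simp) (convex_Icc 0 4)
      isCompact_Icc
  have hLip : ∀ x ∈ Set.Icc (0 : ℝ) 4, ∀ y ∈ Set.Icc (0 : ℝ) 4,
      |φ x - φ y| ≤ (L : ℝ) * |x - y| := by
    intro x hx y hy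
    simpa [Real.dist_eq] using hLw.dist_le_mul x hx y hy
  have hψ0 : psin d δ φ 0 = psiinf d δ := by
    funext ξ
    unfold psin phin psiinf
    simp [hφ_one 0 (by simp)]
  set B : ℝ × (EuclideanSpace ℝ (Fin d) × EuclideanSpace ℝ (Fin d)) → ℝ := fun p =>
    (2 * (L : ℝ) + 2) * (a p.1 p.2.1 *
      (1 + ‖p.2.1 - p.2.2‖ ^ 2) ^ (-((d : ℝ) + 2 * (α + δ - 1)) / 2)) with hB
  have hBi : Integrable B
      ((volume.restrict (Set.Icc (0 : ℝ) t)).prod (volume.prod volume)) :=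
    (integrable_bound d t (2 * (α + δ - 1)) (by linarith) a ha_meas ha_nonneg ha_bdd).const_mul _
  have ham : Measurable (fun p : ℝ × (EuclideanSpace ℝ (Fin d) × EuclideanSpace ℝ (Fin d)) =>
      a p.1 p.2.1) :=
    ha_meas.comp (by fun_prop : Measurable
      (fun p : ℝ × (EuclideanSpace ℝ (Fin d) × EuclideanSpace ℝ (Fin d)) => (p.1, p.2.1)))
  have hFm : ∀ n : ℕ, AEStronglyMeasurable
        (fun p : ℝ × (EuclideanSpace ℝ (Fin d) × EuclideanSpace ℝ (Fin d)) =>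
          Kker d α p.2.1 p.2.2 * a p.1 p.2.1 * (psin d δ φ n p.2.2 - psin d δ φ n p.2.1))
        ((volume.restrict (Set.Icc (0 : ℝ) t)).prod (volume.prod volume)) := by
    intro n
    have h1 := measurable_psin d δ φ hφc n
    have h2 : Measurable
        (fun p : ℝ × (EuclideanSpace ℝ (Fin d) × EuclideanSpace ℝ (Fin d)) =>
          Kker d α p.2.1 p.2.2) := (measurable_Kker d α).comp measurable_snd
    refine Measurable.aestronglyMeasurable ?_
    exact (h2.mul ham).mul ((h1.comp (by fun_prop)).sub (h1.comp (by fun_prop)))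
  have hFb : ∀ n : ℕ, ∀ p : ℝ × (EuclideanSpace ℝ (Fin d) × EuclideanSpace ℝ (Fin d)),
      ‖Kker d α p.2.1 p.2.2 * a p.1 p.2.1 * (psin d δ φ n p.2.2 - psin d δ φ n p.2.1)‖ ≤ B p := by
    intro n p
    have hk := kernel_bound d α δ L L.2 (by linarith) hδ1 φ hφ_anti hφ_range hφ_zero hLip n
      p.2.1 p.2.2
    rw [Real.norm_eq_abs, abs_mul, abs_mul, abs_of_nonneg (Kker_nonneg _ _ _ _),
      abs_of_nonneg (ha_nonneg _ _)]
    have := mul_le_mul_of_nonneg_left hk (ha_nonneg p.1 p.2.1)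
    rw [hB]
    simp only
    linarith
  have hFi : ∀ n : ℕ, Integrable
        (fun p : ℝ × (EuclideanSpace ℝ (Fin d) × EuclideanSpace ℝ (Fin d)) =>
          Kker d α p.2.1 p.2.2 * a p.1 p.2.1 * (psin d δ φ n p.2.2 - psin d δ φ n p.2.1))
        ((volume.restrict (Set.Icc (0 : ℝ) t)).prod (volume.prod volume)) :=
    fun n => hBi.mono' (hFm n) (ae_of_all _ (hFb n))
  have hF0 := hFi 0
  rw [hψ0] at hF0
  refine ⟨fun n _ => hFi n, hF0, ?_⟩
  have hlim : ∀ ξ, Tendsto (fun n => psin d δ φ n ξ) atTop (𝓝 (psiinf d δ ξ)) := by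
    intro ξ
    apply tendsto_const_nhds.congr'
    filter_upwards [eventually_ge_atTop (⌈‖ξ‖⌉₊)] with n hn
    have h1 : ‖ξ‖ ≤ n := (Nat.le_ceil _).trans (by exact_mod_cast hn)
    unfold psin phin psiinf
    rw [hφ_one _ ⟨by positivity, div_le_one_of_le₀ h1 (by positivity)⟩, one_mul]
  rw [integral_triple d t (fun s ξ η => Kker d α ξ η * a s ξ * (psiinf d δ η - psiinf d δ ξ)) hF0]
  have e : ∀ n : ℕ, _ := fun n => integral_triple d t
    (fun s ξ η => Kker d α ξ η * a s ξ * (psin d δ φ n η - psin d δ φ n ξ)) (hFi n)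
  simp_rw [e]
  exact tendsto_integral_of_dominated_convergence B hFm hBi (fun n => ae_of_all _ (hFb n))
    (ae_of_all _ fun p => ((hlim _).sub (hlim _)).const_mul _)

end
end
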